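/- Fix P and D with 0 < P < D < 1/2, and let υ = √(1 + P² − 2D). Then the function P' ↦ ħ(D, P') is differentiable at P with derivative ((υ − P)/(2υ))·log((1 − P + υ)/(1 + P − υ)). -/

import Mathlib

/-- The binary entropy function (natural logarithm, `Real.log 0 = 0`). -/
noncomputable def Hb (a : ℝ) : ℝ :=
  -(a * Real.log a) - (1 - a) * Real.log (1 - a)

/-- The function `ħ(D,P)` from the paper. -/
noncomputable def hbar (D P : ℝ) : ℝ :=
  if D < 1 / 2 then
    Hb ((1 + min D P - Real.sqrt (1 + (min D P) ^ 2 - 2 * D)) / 2)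
  else Real.log 2

theorem Hb_eq_binEntropy : Hb = Real.binEntropy := by
  funext a
  rw [Hb, Real.binEntropy, Real.log_inv, Real.log_inv]
  ring

theorem hasDerivAt_Hb {a : ℝ} (ha₀ : 0 < a) (ha₁ : a < 1) :
    HasDerivAt Hb (Real.log ((1 - a) / a)) a := by
  rw [Hb_eq_binEntropy, Real.log_div (sub_pos.2 ha₁).ne' ha₀.ne']
  exact Real.hasDerivAt_binEntropy ha₀.ne' ha₁.ne

theorem hbar_eventuallyEq_of_lt {D P : ℝ} (hPD : P < D) (hD : D < 1 / 2) :
    (fun P' => hbar D P') =ᶠ[nhds P]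
      fun P' => Hb ((1 + P' - Real.sqrt (1 + P' ^ 2 - 2 * D)) / 2) := by
  filter_upwards [eventually_lt_nhds hPD] with x hx
  rw [hbar, if_pos hD, min_eq_right hx.le]

theorem hasDerivAt_sqrt_one_add_sq_sub {D P : ℝ} (h : 1 + P ^ 2 - 2 * D ≠ 0) :
    HasDerivAt (fun x => Real.sqrt (1 + x ^ 2 - 2 * D))
      (P / Real.sqrt (1 + P ^ 2 - 2 * D)) P := by
  have hsq : HasDerivAt (fun x : ℝ => 1 + x ^ 2 - 2 * D) (2 * P) P := by
    simpa using ((hasDerivAt_pow 2 P).const_add 1).sub_const (2 * D)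
  convert hsq.sqrt h using 1
  rw [mul_div_mul_left _ _ two_ne_zero]

/-- For `0 < P < D < 1/2`, the partial derivative of `ħ` in `P` is
`((υ−P)/(2υ))·log((1−P+υ)/(1+P−υ))` with `υ = √(1+P²−2D)`. -/
theorem hbar_hasDerivAt_snd (D P : ℝ) (hP : 0 < P) (hPD : P < D) (hD : D < 1 / 2) :
    HasDerivAt (fun P' => hbar D P')
      (((Real.sqrt (1 + P ^ 2 - 2 * D) - P) / (2 * Real.sqrt (1 + P ^ 2 - 2 * D))) *
        Real.log ((1 - P + Real.sqrt (1 + P ^ 2 - 2 * D)) /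
          (1 + P - Real.sqrt (1 + P ^ 2 - 2 * D)))) P := by
  have hrad : 0 < 1 + P ^ 2 - 2 * D := by nlinarith
  have hυ := hasDerivAt_sqrt_one_add_sq_sub hrad.ne'
  have hυ_pos := Real.sqrt_pos.2 hrad
  have hυ_lt : Real.sqrt (1 + P ^ 2 - 2 * D) < 1 + P :=
    (Real.sqrt_lt' (by linarith)).2 (by nlinarith)
  refine HasDerivAt.congr_of_eventuallyEq ?_ (hbar_eventuallyEq_of_lt hPD hD)
  set υ := Real.sqrt (1 + P ^ 2 - 2 * D)
  have hinner : HasDerivAt (fun x => (1 + x - Real.sqrt (1 + x ^ 2 - 2 * D)) / 2)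
      ((1 - P / υ) / 2) P :=
    (((hasDerivAt_id P).const_add 1).sub hυ).div_const 2
  have hHb : HasDerivAt Hb (Real.log ((1 - (1 + P - υ) / 2) / ((1 + P - υ) / 2)))
      ((1 + P - υ) / 2) :=
    hasDerivAt_Hb (by linarith) (by linarith)
  refine (hHb.comp P hinner).congr_deriv ?_
  have hratio : (1 - (1 + P - υ) / 2) / ((1 + P - υ) / 2) = (1 - P + υ) / (1 + P - υ) := by
    rw [← div_div_div_cancel_right₀ two_ne_zero (1 - P + υ)]
    ring
  rw [hratio, mul_comm]
  congr 1
  field_simp
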